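/- arXiv:2302.05497 — 2 statements merged into one kernel-verified Lean document; each statement's English description precedes it below -/
import Mathlib

section
/- If A ⊆ V and B ⊆ V are both r-absorbing, then A ∩ B is r-absorbing. -/
open Finset

section ZRP

variable {V : Type*} [Fintype V] [DecidableEq V]

/-- Irreducibility of a set of transition rates. -/
def IrreducibleRates (r : V → V → ℝ) : Prop :=
  ∀ i j : V, i ≠ j → ∃ (m : ℕ) (k : ℕ → V), k 0 = i ∧ k m = j ∧ ∀ l < m, 0 < r (k l) (k (l + 1))

/-- `ind A j` plays the role of the vector `1^A_j`: it equals the indicator of `{j}` on `A`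
and is harmonic (for the generator of `r`) at every point outside `A`. -/
def IsHarmFamily (r : V → V → ℝ) (ind : Finset V → V → V → ℝ) : Prop :=
  ∀ (A : Finset V), ∀ j ∈ A,
    (∀ i ∈ A, ind A j i = if i = j then (1 : ℝ) else 0) ∧
    (∀ k, k ∉ A → ∑ l, r k l * (ind A j l - ind A j k) = 0)

/-- The trace rates `r^A(i,j) = r(i,j) + ∑_{k∉A} r(i,k)·1^A_j(k)` (for `i ≠ j`). -/
noncomputable def traceRate (r : V → V → ℝ) (ind : Finset V → V → V → ℝ)
    (A : Finset V) (i j : V) : ℝ :=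
  if i = j then 0 else r i j + ∑ k ∈ Aᶜ, r i k * ind A j k

/-- `λ^A(i) = ∑_{j∈A} (r^A(j,i) − r^A(i,j))`. -/
noncomputable def lamA (r : V → V → ℝ) (ind : Finset V → V → V → ℝ)
    (A : Finset V) (i : V) : ℝ :=
  ∑ j ∈ A, (traceRate r ind A j i - traceRate r ind A i j)

/-- `A` is `r`-absorbing if `A = V` or `λ^{A∪{j}}(j) ≤ 0` for every `j ∉ A`. -/
def IsAbsorbing (r : V → V → ℝ) (ind : Finset V → V → V → ℝ) (A : Finset V) : Prop :=
  A = Finset.univ ∨ ∀ j ∉ A, lamA r ind (insert j A) j ≤ 0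

/-- The support `𝒮(u) = {i : u i > 0}`. -/
noncomputable def suppF (u : V → ℝ) : Finset V :=
  open scoped Classical in Finset.univ.filter (fun i => 0 < u i)

/-- `𝒜(S)`: the intersection of all `r`-absorbing subsets of `V` containing `S`. -/
noncomputable def minAbs (r : V → V → ℝ) (ind : Finset V → V → V → ℝ) (S : Finset V) :
    Finset V :=
  open scoped Classical in
  Finset.univ.filter (fun i => ∀ A : Finset V, IsAbsorbing r ind A → S ⊆ A → i ∈ A)

/-- The vector `v_i = ∑_k r(i,k)(1_{k} − 1_{i})`. -/
noncomputable def vvec (r : V → V → ℝ) (i : V) : V → ℝ :=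
  fun l => ∑ k, r i k * ((if l = k then (1 : ℝ) else 0) - (if l = i then (1 : ℝ) else 0))

/-- The vector `λ(j) = ∑_i (r(i,j) − r(j,i))`. -/
noncomputable def lamV (r : V → V → ℝ) : V → ℝ := fun j => ∑ i, (r i j - r j i)

/-- Membership in `D_B`: `f` is `C¹` on an open set containing the simplex and
`⟨∇f(u), v_i⟩ = 0` whenever `u ∈ Σ`, `u i = 0`, for every `i ∈ B`. -/
def MemD (r : V → V → ℝ) (B : Finset V) (f : (V → ℝ) → ℝ) : Prop :=
  (∃ U : Set (V → ℝ), IsOpen U ∧ stdSimplex ℝ V ⊆ U ∧ ContDiffOn ℝ 1 f U) ∧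
  ∀ i ∈ B, ∀ u ∈ stdSimplex ℝ V, u i = 0 → fderiv ℝ f u (vvec r i) = 0

/-- Condition (A). -/
def CondA (r : V → V → ℝ) (ζ : ℝ → V → ℝ) : Prop :=
  ∀ f : (V → ℝ) → ℝ, MemD r Finset.univ f → ∀ t : ℝ, 0 ≤ t →
    f (ζ t) = f (ζ 0) + ∫ s in (0:ℝ)..t, fderiv ℝ f (ζ s) (lamV r)

/-- A continuous path in the simplex (for nonnegative times). -/
def IsPath (ζ : ℝ → V → ℝ) : Prop :=
  ContinuousOn ζ (Set.Ici 0) ∧ ∀ t : ℝ, 0 ≤ t → ζ t ∈ stdSimplex ℝ V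

/-- `Σ_abs`: the configurations whose support is `r`-absorbing. -/
def SigmaAbs (r : V → V → ℝ) (ind : Finset V → V → V → ℝ) : Set (V → ℝ) :=
  {u | u ∈ stdSimplex ℝ V ∧ IsAbsorbing r ind (suppF u)}

/-- Condition (B): `inf{t ≥ 0 : ζ_t ∈ Σ_abs} = 0`. -/
def CondB (r : V → V → ℝ) (ind : Finset V → V → V → ℝ) (ζ : ℝ → V → ℝ) : Prop :=
  ∀ ε : ℝ, 0 < ε → ∃ t : ℝ, 0 ≤ t ∧ t < ε ∧ ζ t ∈ SigmaAbs r ind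

end ZRP

section Generator

variable {V : Type*} [Fintype V]

/-- The generator `Lw(i) = ∑ₖ r(i,k)(w(k) − w(i))` as a linear map. -/
def gen (r : V → V → ℝ) : (V → ℝ) →ₗ[ℝ] (V → ℝ) where
  toFun w i := ∑ k, r i k * (w k - w i)
  map_add' v w := by
    funext i
    simp only [Pi.add_apply, ← sum_add_distrib]
    exact sum_congr rfl fun k _ => by ring
  map_smul' c w := by
    funext i
    simp only [Pi.smul_apply, smul_eq_mul, RingHom.id_apply, mul_sum]
    exact sum_congr rfl fun k _ => by ring

lemma gen_apply (r : V → V → ℝ) (w : V → ℝ) (i : V) :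
    gen r w i = ∑ k, r i k * (w k - w i) := rfl

/-- The total mass `∑ᵢ Lw(i)`, which equals `⟨λ, w⟩`. -/
def genSum (r : V → V → ℝ) : (V → ℝ) →ₗ[ℝ] ℝ :=
  (∑ i, LinearMap.proj i) ∘ₗ gen r

lemma genSum_apply (r : V → V → ℝ) (w : V → ℝ) : genSum r w = ∑ i, gen r w i := by
  simp [genSum]

/-- Nonnegative vectors vanishing on `C` and superharmonic off `C`. -/
structure IsPotential (r : V → V → ℝ) (C : Finset V) (f : V → ℝ) : Prop where
  nonneg : ∀ i, 0 ≤ f i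
  zero : ∀ i ∈ C, f i = 0
  super : ∀ i ∉ C, gen r f i ≤ 0

variable {r : V → V → ℝ} {C : Finset V}

lemma nonneg_of_superharmonic (hr : ∀ i j, 0 ≤ r i j) (hirr : IrreducibleRates r)
    (hC : C.Nonempty) {w : V → ℝ} (hw : ∀ i ∈ C, 0 ≤ w i) (hL : ∀ i ∉ C, gen r w i ≤ 0)
    (i : V) : 0 ≤ w i := by
  obtain ⟨c, hc⟩ := hC
  obtain ⟨x, -, hx⟩ := exists_min_image univ w ⟨c, mem_univ c⟩
  by_contra! hi
  have hneg : w x < 0 := (hx i (mem_univ i)).trans_lt hi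
  have hxc : x ≠ c := by
    rintro rfl
    exact absurd (hw x hc) (not_le.2 hneg)
  obtain ⟨m, k, hk0, hkm, hk⟩ := hirr x c hxc
  have key : ∀ l ≤ m, w (k l) = w x := by
    intro l
    induction l with
    | zero => intro _; rw [hk0]
    | succ l ih =>
      intro hl
      have e := ih (by omega)
      have hnot : k l ∉ C := fun h => by linarith [hw _ h]
      have hterm : ∀ y ∈ univ, 0 ≤ r (k l) y * (w y - w (k l)) := fun y _ =>
        mul_nonneg (hr _ _) (by linarith [hx y (mem_univ y)])
      have hzero := (sum_eq_zero_iff_of_nonneg hterm).1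
        (le_antisymm (hL _ hnot) (sum_nonneg hterm)) (k (l + 1)) (mem_univ _)
      rcases mul_eq_zero.1 hzero with h | h
      · exact absurd h (hk l (by omega)).ne'
      · linarith
  have := key m le_rfl
  rw [hkm] at this
  linarith [hw c hc]

lemma eq_zero_of_harmonic (hr : ∀ i j, 0 ≤ r i j) (hirr : IrreducibleRates r)
    (hC : C.Nonempty) {w : V → ℝ} (hw : ∀ i ∈ C, w i = 0) (hL : ∀ i ∉ C, gen r w i = 0) :
    w = 0 := by
  funext i
  have h₁ := nonneg_of_superharmonic hr hirr hC (w := w) (fun i hi => (hw i hi).ge)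
    (fun i hi => (hL i hi).le) i
  have h₂ := nonneg_of_superharmonic hr hirr hC (w := -w) (fun i hi => by simp [hw i hi])
    (fun i hi => by simp [hL i hi]) i
  simp only [Pi.neg_apply] at h₂
  simpa using le_antisymm (by linarith) h₁

lemma IsPotential.smul {f : V → ℝ} (hf : IsPotential r C f) {c : ℝ} (hc : 0 ≤ c) :
    IsPotential r C (c • f) where
  nonneg i := mul_nonneg hc (hf.nonneg i)
  zero i hi := by simp [hf.zero i hi]
  super i hi := by
    simpa using mul_nonpos_of_nonneg_of_nonpos hc (hf.super i hi)

/-- If `genSum` is positive at some potential, it has a maximizer among potentials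
of unit mass. -/
lemma exists_maximal_potential {f₀ : V → ℝ} (hf₀ : IsPotential r C f₀)
    (hpos : 0 < genSum r f₀) :
    ∃ f, IsPotential r C f ∧ ∑ i, f i = 1 ∧ 0 < genSum r f ∧
      ∀ g, IsPotential r C g → genSum r g ≤ genSum r f * ∑ i, g i := by
  have normalize : ∀ g, IsPotential r C g → ∑ i, g i ≠ 0 →
      (∑ i, g i)⁻¹ • g ∈ {f | IsPotential r C f ∧ ∑ i, f i = 1} := fun g hg h =>
    ⟨hg.smul (inv_nonneg.2 (sum_nonneg fun i _ => hg.nonneg i)), by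
      simp [← mul_sum, inv_mul_cancel₀ h]⟩
  have zero_of_sum : ∀ g, IsPotential r C g → ∑ i, g i = 0 → g = 0 := fun g hg h =>
    funext fun i => (sum_eq_zero_iff_of_nonneg fun i _ => hg.nonneg i).1 h i (mem_univ i)
  have hcont : Continuous (gen r) := (gen r).continuous_of_finiteDimensional
  have hcomp : IsCompact {f | IsPotential r C f ∧ ∑ i, f i = 1} := by
    have : {f | IsPotential r C f ∧ ∑ i, f i = 1} =
        stdSimplex ℝ V ∩ ((⋂ i ∈ C, {f | f i = 0}) ∩ ⋂ i ∉ C, {f | gen r f i ≤ 0}) := by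
      ext f
      simp only [Set.mem_ofPred_eq, Set.mem_inter_iff, Set.mem_iInter, stdSimplex]
      exact ⟨fun h => ⟨⟨h.1.nonneg, h.2⟩, h.1.zero, h.1.super⟩,
        fun h => ⟨⟨h.1.1, h.2.1, h.2.2⟩, h.1.2⟩⟩
    rw [this]
    refine (isCompact_stdSimplex ℝ V).inter_right (IsClosed.inter ?_ ?_)
    · exact isClosed_biInter fun i _ => isClosed_eq (continuous_apply i) continuous_const
    · exact isClosed_iInter fun i => isClosed_iInter fun _ =>
        isClosed_le ((continuous_apply i).comp hcont) continuous_const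
  have hs₀ : ∑ i, f₀ i ≠ 0 := fun h => by
    rw [zero_of_sum f₀ hf₀ h, map_zero] at hpos
    exact hpos.false
  obtain ⟨f, ⟨hf, hf1⟩, hmax⟩ := hcomp.exists_isMaxOn ⟨_, normalize f₀ hf₀ hs₀⟩
    (genSum r).continuous_of_finiteDimensional.continuousOn
  have hle : ∀ g, IsPotential r C g → genSum r g ≤ genSum r f * ∑ i, g i := by
    intro g hg
    by_cases h : ∑ i, g i = 0
    · simp [zero_of_sum g hg h]
    · have hs : 0 < ∑ i, g i := (sum_nonneg fun i _ => hg.nonneg i).lt_of_ne' h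
      have := hmax (normalize g hg h)
      simp only [Set.mem_ofPred_eq, map_smul, smul_eq_mul] at this
      rwa [inv_mul_le_iff₀ hs, mul_comm] at this
  refine ⟨f, hf, hf1, ?_, hle⟩
  exact pos_of_mul_pos_left (hpos.trans_le (hle f₀ hf₀))
    (sum_nonneg fun i _ => hf₀.nonneg i)

end Generator

section Absorbing

variable {V : Type*} [Fintype V] [DecidableEq V] {r : V → V → ℝ}
  {ind : Finset V → V → V → ℝ}

namespace IsHarmFamily

lemma gen_eq_zero (hind : IsHarmFamily r ind) {S : Finset V} {j k : V} (hj : j ∈ S)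
    (hk : k ∉ S) : gen r (ind S j) k = 0 :=
  (hind S j hj).2 k hk

lemma apply_self (hind : IsHarmFamily r ind) {S : Finset V} {j : V} (hj : j ∈ S) :
    ind S j j = 1 := by
  simp [(hind S j hj).1 j hj]

lemma apply_of_ne (hind : IsHarmFamily r ind) {S : Finset V} {i j : V} (hj : j ∈ S)
    (hi : i ∈ S) (hij : i ≠ j) : ind S j i = 0 := by
  simp [(hind S j hj).1 i hi, hij]

lemma gen_eq_traceRate (hind : IsHarmFamily r ind) {S : Finset V} {i j : V} (hj : j ∈ S)
    (hi : i ∈ S) (hij : i ≠ j) : gen r (ind S j) i = traceRate r ind S i j := by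
  rw [gen_apply, traceRate, if_neg hij, hind.apply_of_ne hj hi hij,
    ← sum_add_sum_compl S]
  congr 1
  · rw [sum_eq_single_of_mem j hj fun k hk hkj => by rw [hind.apply_of_ne hj hk hkj]; ring,
      hind.apply_self hj]
    ring
  · simp

/-- The harmonic extension of `f` from `A`. -/
lemma exists_extension (hind : IsHarmFamily r ind) (A : Finset V) (f : V → ℝ) :
    (∀ i ∈ A, (∑ a ∈ A, f a • ind A a) i = f i) ∧
      ∀ i ∉ A, gen r (∑ a ∈ A, f a • ind A a) i = 0 := by
  constructor
  · intro i hi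
    rw [Finset.sum_apply, sum_eq_single_of_mem i hi fun a ha hai => by
      simp [hind.apply_of_ne ha hi hai.symm]]
    simp [hind.apply_self hi]
  · intro i hi
    rw [map_sum, Finset.sum_apply]
    exact sum_eq_zero fun a ha => by simp [hind.gen_eq_zero ha hi]

lemma sum_eq_one (hind : IsHarmFamily r ind) (hr : ∀ i j, 0 ≤ r i j)
    (hirr : IrreducibleRates r) {S : Finset V} (hS : S.Nonempty) :
    ∑ a ∈ S, ind S a = 1 := by
  have hext := hind.exists_extension S 1
  simp only [Pi.one_apply, one_smul] at hext
  have h1 : gen r 1 = 0 := by funext i; simp [gen_apply]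
  refine sub_eq_zero.1 (eq_zero_of_harmonic hr hirr hS (fun i hi => ?_) fun i hi => ?_)
  · rw [Pi.sub_apply, hext.1 i hi, Pi.one_apply, sub_self]
  · rw [map_sub, h1, sub_zero, hext.2 i hi]

lemma lamA_eq_genSum (hind : IsHarmFamily r ind) (hr : ∀ i j, 0 ≤ r i j)
    (hirr : IrreducibleRates r) {S : Finset V} {j : V} (hj : j ∈ S) :
    lamA r ind S j = genSum r (ind S j) := by
  have hself : gen r (ind S j) j = -∑ a ∈ S.erase j, traceRate r ind S j a := by
    have h := congrArg (gen r · j) (hind.sum_eq_one hr hirr ⟨j, hj⟩)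
    simp only [map_sum, Finset.sum_apply] at h
    rw [← add_sum_erase S _ hj, sum_congr rfl fun a ha => hind.gen_eq_traceRate
      (mem_of_mem_erase ha) hj (ne_of_mem_erase ha).symm] at h
    have h1 : gen r 1 j = 0 := by simp [gen_apply]
    linarith
  rw [genSum_apply, ← sum_add_sum_compl S, sum_eq_zero (s := Sᶜ) fun i hi =>
    hind.gen_eq_zero hj (mem_compl.1 hi), add_zero, ← add_sum_erase S _ hj, hself,
    sum_congr rfl fun a ha => hind.gen_eq_traceRate hj (mem_of_mem_erase ha)
    (ne_of_mem_erase ha), lamA, ← add_sum_erase S _ hj, sum_sub_distrib]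
  ring

variable {A C : Finset V}

lemma gen_self_neg (hind : IsHarmFamily r ind) (hr : ∀ i j, 0 ≤ r i j)
    (hirr : IrreducibleRates r) (hA : A.Nonempty) {j : V} (hj : j ∉ A) :
    gen r (ind (insert j A) j) j < 0 := by
  have hjS := mem_insert_self j A
  by_contra! h
  have := nonneg_of_superharmonic hr hirr hA (w := -ind (insert j A) j) (fun i hi => by
    simp [hind.apply_of_ne hjS (mem_insert_of_mem hi) (ne_of_mem_of_not_mem hi hj)])
    (fun i hi => by
      rw [map_neg, Pi.neg_apply, neg_nonpos]
      rcases eq_or_ne i j with rfl | hij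
      · exact h
      · exact (hind.gen_eq_zero hjS (by simp [hij, hi])).ge) j
  rw [Pi.neg_apply, hind.apply_self hjS] at this
  linarith

lemma isPotential (hind : IsHarmFamily r ind) (hr : ∀ i j, 0 ≤ r i j)
    (hirr : IrreducibleRates r) (hA : A.Nonempty) {j : V} (hj : j ∉ A) :
    IsPotential r A (ind (insert j A) j) := by
  have hjS := mem_insert_self j A
  have hzero : ∀ i ∈ A, ind (insert j A) j i = 0 := fun i hi =>
    hind.apply_of_ne hjS (mem_insert_of_mem hi) (ne_of_mem_of_not_mem hi hj)
  have hsuper : ∀ i ∉ A, gen r (ind (insert j A) j) i ≤ 0 := by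
    intro i hi
    rcases eq_or_ne i j with rfl | hij
    · exact (hind.gen_self_neg hr hirr hA hj).le
    · exact (hind.gen_eq_zero hjS (by simp [hij, hi])).le
  exact ⟨nonneg_of_superharmonic hr hirr hA (fun i hi => (hzero i hi).ge) hsuper,
    hzero, hsuper⟩

lemma genSum_nonpos (hind : IsHarmFamily r ind) (hr : ∀ i j, 0 ≤ r i j)
    (hirr : IrreducibleRates r) (hA : A.Nonempty) (habs : IsAbsorbing r ind A)
    {f : V → ℝ} (hf : IsPotential r A f) : genSum r f ≤ 0 := by
  rcases habs with rfl | habs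
  · rw [show f = 0 from funext fun i => hf.zero i (mem_univ i), map_zero]
  let u : V → V → ℝ := fun j => ind (insert j A) j
  let c : V → ℝ := fun j => gen r f j / gen r (u j) j
  have hdecomp : f - ∑ j ∈ Aᶜ, c j • u j = 0 := by
    refine eq_zero_of_harmonic hr hirr hA (fun i hi => ?_) fun i hi => ?_
    · rw [Pi.sub_apply, hf.zero i hi, Finset.sum_apply, sum_eq_zero fun j hj => by
        simp [u, (hind.isPotential hr hirr hA (mem_compl.1 hj)).zero i hi], sub_zero]
    · have hne : gen r (u i) i ≠ 0 := (hind.gen_self_neg hr hirr hA hi).ne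
      rw [map_sub, map_sum, Pi.sub_apply, Finset.sum_apply,
        sum_eq_single_of_mem i (mem_compl.2 hi) fun j _ hji => by
          simp [u, hind.gen_eq_zero (mem_insert_self j A)
            (show i ∉ insert j A by simp [hji.symm, hi])]]
      simp [c, div_mul_cancel₀ _ hne]
  rw [sub_eq_zero.1 hdecomp, map_sum]
  refine sum_nonpos fun j hj => ?_
  have hj := mem_compl.1 hj
  rw [map_smul, smul_eq_mul]
  refine mul_nonpos_of_nonneg_of_nonpos (div_nonneg_of_nonpos (hf.super j hj)
    (hind.gen_self_neg hr hirr hA hj).le) ?_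
  rw [← hind.lamA_eq_genSum hr hirr (mem_insert_self j A)]
  exact habs j hj

/-- Replacing a potential by its harmonic extension from an absorbing set gives a smaller
potential with a larger `genSum`. -/
lemma exists_reduced_potential (hind : IsHarmFamily r ind) (hr : ∀ i j, 0 ≤ r i j)
    (hirr : IrreducibleRates r) (hC : C.Nonempty) (hCA : C ⊆ A) (habs : IsAbsorbing r ind A)
    {f : V → ℝ} (hf : IsPotential r C f) :
    ∃ g, IsPotential r C g ∧ (∀ i, g i ≤ f i) ∧ (∀ i ∉ A, gen r g i = 0) ∧
      genSum r f ≤ genSum r g := by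
  obtain ⟨hgA, hgL⟩ := hind.exists_extension A f
  set g := ∑ a ∈ A, f a • ind A a
  have hA : A.Nonempty := hC.mono hCA
  have hdiff : IsPotential r A (f - g) := by
    have hzero : ∀ i ∈ A, (f - g) i = 0 := fun i hi => by
      rw [Pi.sub_apply, hgA i hi, sub_self]
    have hsuper : ∀ i ∉ A, gen r (f - g) i ≤ 0 := fun i hi => by
      rw [map_sub, Pi.sub_apply, hgL i hi, sub_zero]
      exact hf.super i fun h => hi (hCA h)
    exact ⟨nonneg_of_superharmonic hr hirr hA (fun i hi => (hzero i hi).ge) hsuper,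
      hzero, hsuper⟩
  refine ⟨g, ⟨?_, fun i hi => (hgA i (hCA hi)).trans (hf.zero i hi), fun i hi => ?_⟩,
    fun i => sub_nonneg.1 (hdiff.nonneg i), hgL, ?_⟩
  · exact nonneg_of_superharmonic hr hirr hA (fun i hi => (hgA i hi).symm ▸ hf.nonneg i)
      fun i hi => (hgL i hi).le
  · by_cases hiA : i ∈ A
    · have hge : 0 ≤ gen r (f - g) i := by
        rw [gen_apply, hdiff.zero i hiA]
        exact sum_nonneg fun k _ => mul_nonneg (hr i k) (by
          simpa only [sub_zero] using hdiff.nonneg k)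
      rw [map_sub, Pi.sub_apply] at hge
      linarith [hf.super i hi]
    · exact (hgL i hiA).le
  · have := hind.genSum_nonpos hr hirr hA habs hdiff
    rw [map_sub] at this
    linarith

/-- A `genSum`-maximizing potential is harmonic off every absorbing set. -/
lemma gen_eq_zero_of_maximal (hind : IsHarmFamily r ind) (hr : ∀ i j, 0 ≤ r i j)
    (hirr : IrreducibleRates r) (hC : C.Nonempty) (hCA : C ⊆ A) (habs : IsAbsorbing r ind A)
    {f : V → ℝ} (hf : IsPotential r C f) (hf1 : ∑ i, f i = 1) (hpos : 0 < genSum r f)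
    (hmax : ∀ g, IsPotential r C g → genSum r g ≤ genSum r f * ∑ i, g i) :
    ∀ i ∉ A, gen r f i = 0 := by
  obtain ⟨g, hg, hgf, hgL, hle⟩ := hind.exists_reduced_potential hr hirr hC hCA habs hf
  have h1 : 1 ≤ ∑ i, g i := le_of_mul_le_mul_left (by linarith [hmax g hg]) hpos
  have heq := (sum_eq_sum_iff_of_le fun i _ => hgf i).1
    (le_antisymm (sum_le_sum fun i _ => hgf i) (hf1 ▸ h1))
  rwa [show g = f from funext fun i => heq i (mem_univ i)] at hgL

end IsHarmFamily

end Absorbing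

/-- the intersection of two `r`-absorbing sets is `r`-absorbing. -/
theorem absorbing_inter (V : Type*) [Fintype V] [DecidableEq V] [Nonempty V]
    (r : V → V → ℝ) (hr_nonneg : ∀ i j, 0 ≤ r i j) (hr_diag : ∀ i, r i i = 0)
    (hr_irr : IrreducibleRates r)
    (ind : Finset V → V → V → ℝ) (hind : IsHarmFamily r ind)
    (A B : Finset V) (hA : IsAbsorbing r ind A) (hB : IsAbsorbing r ind B) :
    IsAbsorbing r ind (A ∩ B) := by
  refine Or.inr fun j hj => ?_
  rcases (A ∩ B).eq_empty_or_nonempty with hC | hC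
  · simp [hC, lamA]
  rw [hind.lamA_eq_genSum hr_nonneg hr_irr (mem_insert_self j _)]
  by_contra! hpos
  obtain ⟨f, hf, hf1, hfpos, hmax⟩ :=
    exists_maximal_potential (hind.isPotential hr_nonneg hr_irr hC hj) hpos
  have hfA := hind.gen_eq_zero_of_maximal hr_nonneg hr_irr hC inter_subset_left hA hf hf1
    hfpos hmax
  have hfB := hind.gen_eq_zero_of_maximal hr_nonneg hr_irr hC inter_subset_right hB hf hf1
    hfpos hmax
  have hf0 : f = 0 := eq_zero_of_harmonic hr_nonneg hr_irr hC hf.zero fun i hi => by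
    by_cases hiA : i ∈ A
    · exact hfB i fun hiB => hi (mem_inter.2 ⟨hiA, hiB⟩)
    · exact hfA i hiA
  rw [hf0, map_zero] at hfpos
  exact hfpos.false
end

section
/- Let u ∈ Σ, let λ^u ∈ ℝ^V be the vector equal to λ^{𝒜(u)} on 𝒜(u) and 0 on V∖𝒜(u), and let T^u = inf{t ≥ 0 : u + t·λ^u ∉ Σ}. If T^u < ∞ then, setting v = u + T^u·λ^u, the support 𝒮(v) is r-absorbing (hence 𝒮(v) = 𝒜(v)) and 𝒮(v) is a proper subset of 𝒜(u). -/
open Finset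

section ZeroRange

variable {V : Type*}

theorem IrreducibleRates.forall_of_closed {r : V → V → ℝ} (hr : IrreducibleRates r)
    {P : V → Prop} (hP : ∀ k l, P k → 0 < r k l → P l) {i : V} (hi : P i) (j : V) : P j := by
  by_cases hij : i = j
  · exact hij ▸ hi
  · obtain ⟨m, k, h0, hm, hk⟩ := hr i j hij
    have key : ∀ l ≤ m, P (k l) := by
      intro l
      induction l with
      | zero => intro _; rwa [h0]
      | succ l ih => intro hl; exact hP _ _ (ih (by omega)) (hk l (by omega))
    exact hm ▸ key m le_rfl

variable [Fintype V]

/-- The generator of the rates `r`. -/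
def generator (r : V → V → ℝ) (f : V → ℝ) (k : V) : ℝ := ∑ l, r k l * (f l - f k)

/-- The net inflow at `k` when mass leaves every site `l` with intensity `ρ l`;
this is the adjoint of the generator. -/
def netInflow (r : V → V → ℝ) (ρ : V → ℝ) (k : V) : ℝ := ∑ l, (ρ l * r l k - ρ k * r k l)

theorem sum_mul_netInflow (r : V → V → ℝ) (h ρ : V → ℝ) :
    ∑ k, h k * netInflow r ρ k = ∑ k, ρ k * generator r h k := by
  have e1 : ∑ k, h k * netInflow r ρ k
      = ∑ k, ∑ l, h k * (ρ l * r l k) - ∑ k, ∑ l, h k * (ρ k * r k l) := by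
    simp only [netInflow, Finset.mul_sum, mul_sub, Finset.sum_sub_distrib]
  have e2 : ∑ k, ρ k * generator r h k
      = ∑ k, ∑ l, h l * (ρ k * r k l) - ∑ k, ∑ l, h k * (ρ k * r k l) := by
    simp only [generator, Finset.mul_sum, ← Finset.sum_sub_distrib]
    exact Finset.sum_congr rfl fun k _ => Finset.sum_congr rfl fun l _ => by ring
  rw [e1, e2, Finset.sum_comm]

theorem generator_nonpos_of_forall_le {r : V → V → ℝ} (hr : ∀ i j, 0 ≤ r i j)
    {f : V → ℝ} {k : V} (hk : ∀ l, f l ≤ f k) : generator r f k ≤ 0 :=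
  Finset.sum_nonpos fun l _ => mul_nonpos_of_nonneg_of_nonpos (hr k l) (sub_nonpos.2 (hk l))

theorem eq_of_generator_nonneg {r : V → V → ℝ} (hr : ∀ i j, 0 ≤ r i j)
    {f : V → ℝ} {k : V} (hk : ∀ l, f l ≤ f k) (hg : 0 ≤ generator r f k) {l : V}
    (hl : 0 < r k l) : f l = f k := by
  have hterm : ∀ l ∈ Finset.univ, r k l * (f l - f k) ≤ 0 := fun l _ =>
    mul_nonpos_of_nonneg_of_nonpos (hr k l) (sub_nonpos.2 (hk l))
  have h0 := (Finset.sum_eq_zero_iff_of_nonpos hterm).1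
    (le_antisymm (generator_nonpos_of_forall_le hr hk) hg) l (Finset.mem_univ l)
  rcases mul_eq_zero.1 h0 with h | h
  · exact absurd h hl.ne'
  · exact sub_eq_zero.1 h

/-- The maximum principle. -/
theorem le_of_generator_nonneg {r : V → V → ℝ} (hr : ∀ i j, 0 ≤ r i j)
    (hirr : IrreducibleRates r) {C : Finset V} (hC : C.Nonempty) {f : V → ℝ} {m : ℝ}
    (hfC : ∀ k ∈ C, f k ≤ m) (hf : ∀ k, k ∉ C → 0 ≤ generator r f k) (k : V) : f k ≤ m := by
  obtain ⟨c, hc⟩ := hC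
  obtain ⟨x, -, hx⟩ := Finset.exists_max_image Finset.univ f ⟨c, Finset.mem_univ c⟩
  have hx' : ∀ l, f l ≤ f x := fun l => hx l (Finset.mem_univ l)
  by_contra! hk
  have hmx : m < f x := hk.trans_le (hx' k)
  have hclosed : ∀ k l, f k = f x → 0 < r k l → f l = f x := by
    intro k l hkx hkl
    have hkC : k ∉ C := fun h => absurd (hfC k h) (by linarith)
    rw [← hkx]
    exact eq_of_generator_nonneg hr (fun l => hkx ▸ hx' l) (hf k hkC) hkl
  have := hirr.forall_of_closed (P := fun k => f k = f x) hclosed rfl c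
  linarith [hfC c hc]

theorem generator_neg (r : V → V → ℝ) (f : V → ℝ) (k : V) :
    generator r (fun x => -f x) k = -generator r f k := by
  simp only [generator, ← Finset.sum_neg_distrib]
  exact Finset.sum_congr rfl fun l _ => by ring

theorem le_of_generator_nonpos {r : V → V → ℝ} (hr : ∀ i j, 0 ≤ r i j)
    (hirr : IrreducibleRates r) {C : Finset V} (hC : C.Nonempty) {f : V → ℝ} {m : ℝ}
    (hfC : ∀ k ∈ C, m ≤ f k) (hf : ∀ k, k ∉ C → generator r f k ≤ 0) (k : V) : m ≤ f k := by
  have := le_of_generator_nonneg hr hirr hC (f := fun x => -f x) (m := -m)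
    (fun k hk => neg_le_neg (hfC k hk))
    (fun k hk => by rw [generator_neg]; exact neg_nonneg.2 (hf k hk)) k
  linarith

theorem netInflow_mono {r : V → V → ℝ} (hr : ∀ i j, 0 ≤ r i j) {ρ σ : V → ℝ} (h : ∀ k, ρ k ≤ σ k) {k : V}
    (hk : ρ k = σ k) : netInflow r ρ k ≤ netInflow r σ k := by
  refine Finset.sum_le_sum fun l _ => ?_
  rw [hk]
  exact sub_le_sub_right (mul_le_mul_of_nonneg_right (h l) (hr l k)) _

/-- The exit time of a ray from the simplex whose decreasing coordinates start positive is
positive and attained by a decreasing coordinate. -/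
theorem sInf_exit_stdSimplex {u d : V → ℝ} (hu : u ∈ stdSimplex ℝ V) (hd : ∑ i, d i = 0)
    (hpos : ∀ i, d i < 0 → 0 < u i)
    (hne : {t : ℝ | 0 ≤ t ∧ (fun i => u i + t * d i) ∉ stdSimplex ℝ V}.Nonempty) :
    ∃ τ > 0, sInf {t : ℝ | 0 ≤ t ∧ (fun i => u i + t * d i) ∉ stdSimplex ℝ V} = τ ∧
      (∀ i, 0 ≤ u i + τ * d i) ∧ ∃ i, d i < 0 ∧ u i + τ * d i = 0 := by
  classical
  have hmem : ∀ t : ℝ, (fun i => u i + t * d i) ∈ stdSimplex ℝ V ↔ ∀ i, 0 ≤ u i + t * d i := by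
    intro t
    refine ⟨fun h => h.1, fun h => ⟨h, ?_⟩⟩
    rw [Finset.sum_add_distrib, ← Finset.mul_sum, hd, hu.2, mul_zero, add_zero]
  have hdec : (Finset.univ.filter fun i => d i < 0).Nonempty := by
    obtain ⟨t, ht, hnot⟩ := hne
    by_contra! hempty
    refine hnot ((hmem t).2 fun i => add_nonneg (hu.1 i) (mul_nonneg ht ?_))
    by_contra! hi
    exact Finset.notMem_empty i (hempty ▸ Finset.mem_filter.2 ⟨Finset.mem_univ i, hi⟩)
  obtain ⟨m, hm, hmin⟩ := Finset.exists_min_image _ (fun i => u i / -d i) hdec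
  simp only [Finset.mem_filter, Finset.mem_univ, true_and] at hm hmin
  have hτ : 0 < u m / -d m := div_pos (hpos m hm) (neg_pos.2 hm)
  have hzero : u m + u m / -d m * d m = 0 := by
    field_simp [hm.ne]
    ring
  have hnonneg : ∀ t, 0 ≤ t → t ≤ u m / -d m → ∀ i, 0 ≤ u i + t * d i := by
    intro t ht htle i
    rcases lt_or_ge (d i) 0 with hi | hi
    · have := (le_div_iff₀ (neg_pos.2 hi)).1 (htle.trans (hmin i hi))
      linarith
    · exact add_nonneg (hu.1 i) (mul_nonneg ht hi)
  refine ⟨u m / -d m, hτ, ?_, hnonneg _ hτ.le le_rfl, m, hm, hzero⟩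
  have hset : {t : ℝ | 0 ≤ t ∧ (fun i => u i + t * d i) ∉ stdSimplex ℝ V}
      = Set.Ioi (u m / -d m) := by
    ext t
    simp only [Set.mem_ofPred_eq, Set.mem_Ioi, hmem]
    constructor
    · rintro ⟨ht, hnot⟩
      by_contra! hle
      exact hnot (hnonneg t ht hle)
    · intro ht
      refine ⟨(hτ.trans ht).le, fun h => ?_⟩
      nlinarith [h m]
  rw [hset, csInf_Ioi]

theorem mem_suppF {u : V → ℝ} {i : V} : i ∈ suppF u ↔ 0 < u i := by
  classical
  simp [suppF]

variable [DecidableEq V] {r : V → V → ℝ} {ind : Finset V → V → V → ℝ}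

theorem IsHarmFamily.generator_eq_zero (hind : IsHarmFamily r ind) {C : Finset V} {j k : V}
    (hj : j ∈ C) (hk : k ∉ C) : generator r (ind C j) k = 0 :=
  (hind C j hj).2 k hk

theorem IsHarmFamily.nonneg (hind : IsHarmFamily r ind) (hr : ∀ i j, 0 ≤ r i j)
    (hirr : IrreducibleRates r) {C : Finset V} {j : V} (hj : j ∈ C) (k : V) :
    0 ≤ ind C j k := by
  refine le_of_generator_nonpos hr hirr ⟨j, hj⟩ (fun k hk => ?_)
    (fun k hk => (hind.generator_eq_zero hj hk).le) k
  rw [(hind C j hj).1 k hk]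
  split_ifs <;> norm_num

theorem IsHarmFamily.le_one (hind : IsHarmFamily r ind) (hr : ∀ i j, 0 ≤ r i j)
    (hirr : IrreducibleRates r) {C : Finset V} {j : V} (hj : j ∈ C) (k : V) :
    ind C j k ≤ 1 := by
  refine le_of_generator_nonneg hr hirr ⟨j, hj⟩ (fun k hk => ?_)
    (fun k hk => (hind.generator_eq_zero hj hk).ge) k
  rw [(hind C j hj).1 k hk]
  split_ifs <;> norm_num

theorem IsHarmFamily.apply_self_s4 (hind : IsHarmFamily r ind) {C : Finset V} {j : V}
    (hj : j ∈ C) : ind C j j = 1 := by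
  simp [(hind C j hj).1 j hj]

theorem IsHarmFamily.apply_of_ne_s4 (hind : IsHarmFamily r ind) {C : Finset V} {i j : V}
    (hj : j ∈ C) (hi : i ∈ C) (hij : i ≠ j) : ind C j i = 0 := by
  simp [(hind C j hj).1 i hi, hij]

theorem IsHarmFamily.generator_self_nonpos (hind : IsHarmFamily r ind)
    (hr : ∀ i j, 0 ≤ r i j) (hirr : IrreducibleRates r) {C : Finset V} {j : V} (hj : j ∈ C) :
    generator r (ind C j) j ≤ 0 :=
  generator_nonpos_of_forall_le hr fun l => by
    rw [hind.apply_self_s4 hj]; exact hind.le_one hr hirr hj l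

theorem IsHarmFamily.generator_self_neg (hind : IsHarmFamily r ind)
    (hr : ∀ i j, 0 ≤ r i j) (hirr : IrreducibleRates r) {A : Finset V} (hA : A.Nonempty)
    {j : V} (hj : j ∉ A) : generator r (ind (insert j A) j) j < 0 := by
  have hjC : j ∈ insert j A := Finset.mem_insert_self j A
  refine lt_of_le_of_ne (hind.generator_self_nonpos hr hirr hjC) fun h0 => ?_
  obtain ⟨a, ha⟩ := hA
  have hzero : ∀ a ∈ A, ind (insert j A) j a = 0 := fun a ha =>
    hind.apply_of_ne_s4 hjC (Finset.mem_insert_of_mem ha) (fun h => hj (h ▸ ha))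
  have hclosed : ∀ k l, ind (insert j A) j k = 1 → 0 < r k l → ind (insert j A) j l = 1 := by
    intro k l hk hkl
    have hg : generator r (ind (insert j A) j) k = 0 := by
      by_cases hkj : k = j
      · rw [hkj, h0]
      · refine hind.generator_eq_zero hjC fun hkC => ?_
        have := hzero k ((Finset.mem_insert.1 hkC).resolve_left hkj)
        linarith
    rw [← hk]
    exact eq_of_generator_nonneg hr (fun l => hk ▸ hind.le_one hr hirr hjC l) hg.ge hkl
  have := hirr.forall_of_closed hclosed (hind.apply_self_s4 hjC) a
  rw [hzero a ha] at this
  norm_num at this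

theorem IsHarmFamily.sum_eq_one_s4 (hind : IsHarmFamily r ind) (hr : ∀ i j, 0 ≤ r i j)
    (hirr : IrreducibleRates r) {C : Finset V} (hC : C.Nonempty) (k : V) :
    ∑ j ∈ C, ind C j k = 1 := by
  have hon : ∀ k ∈ C, ∑ j ∈ C, ind C j k = 1 := by
    intro k hk
    rw [Finset.sum_congr rfl fun j hj => (hind C j hj).1 k hk]
    simp [hk]
  have hoff : ∀ k, k ∉ C → generator r (fun k => ∑ j ∈ C, ind C j k) k = 0 := by
    intro k hk
    have : generator r (fun k => ∑ j ∈ C, ind C j k) k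
        = ∑ j ∈ C, generator r (ind C j) k := by
      simp only [generator]
      rw [Finset.sum_comm]
      simp only [← Finset.mul_sum, ← Finset.sum_sub_distrib]
    rw [this]
    exact Finset.sum_eq_zero fun j hj => hind.generator_eq_zero hj hk
  exact le_antisymm
    (le_of_generator_nonneg hr hirr hC (fun k hk => (hon k hk).le) (fun k hk => (hoff k hk).ge) k)
    (le_of_generator_nonpos hr hirr hC (fun k hk => (hon k hk).ge) (fun k hk => (hoff k hk).le) k)

theorem IsHarmFamily.sum_rate_mul (hind : IsHarmFamily r ind) {C : Finset V} {i : V}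
    (hi : i ∈ C) (j : V) :
    ∑ k, r j k * ind C i k = r j i + ∑ k ∈ Cᶜ, r j k * ind C i k := by
  rw [← Finset.sum_add_sum_compl C, Finset.sum_congr rfl fun k hk => by
    rw [(hind C i hi).1 k hk]]
  simp [hi]

theorem lamA_eq_sum_generator (hind : IsHarmFamily r ind) (hr : ∀ i j, 0 ≤ r i j)
    (hirr : IrreducibleRates r) {C : Finset V} {i : V} (hi : i ∈ C) :
    lamA r ind C i = ∑ k, generator r (ind C i) k := by
  have htr : ∀ j ∈ C, traceRate r ind C j i - traceRate r ind C i j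
      = ∑ k, r j k * ind C i k - ∑ k, r i k * ind C j k := by
    intro j hj
    by_cases hij : i = j
    · simp [hij]
    · rw [hind.sum_rate_mul hi, hind.sum_rate_mul hj]
      simp [traceRate, hij, Ne.symm hij]
  have hout : ∑ j ∈ C, ∑ k, r i k * ind C j k = ∑ k, r i k := by
    rw [Finset.sum_comm]
    simp only [← Finset.mul_sum, hind.sum_eq_one_s4 hr hirr ⟨i, hi⟩, mul_one]
  have hgen : ∑ k, generator r (ind C i) k = ∑ k ∈ C, generator r (ind C i) k :=
    (Finset.sum_subset (Finset.subset_univ C)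
      fun k _ hk => hind.generator_eq_zero hi hk).symm
  have hself : ∑ j ∈ C, ∑ k, r j k * ind C i j = ∑ k, r i k := by
    rw [Finset.sum_eq_single_of_mem i hi fun j hj hji => by
      simp [hind.apply_of_ne_s4 hi hj hji], hind.apply_self_s4 hi]
    simp
  rw [hgen, lamA, Finset.sum_congr rfl htr, Finset.sum_sub_distrib, hout]
  simp only [generator, mul_sub, Finset.sum_sub_distrib]
  rw [hself]

theorem sum_lamA (r : V → V → ℝ) (ind : Finset V → V → V → ℝ) (A : Finset V) :
    ∑ i ∈ A, lamA r ind A i = 0 := by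
  simp only [lamA, Finset.sum_sub_distrib]
  rw [Finset.sum_comm, sub_self]

/-- Sufficient condition for absorption through a subsolution of the stationarity equations. -/
theorem isAbsorbing_of_netInflow_nonpos (hind : IsHarmFamily r ind) (hr : ∀ i j, 0 ≤ r i j)
    (hirr : IrreducibleRates r) {B : Finset V} {ρ : V → ℝ} (hρ : ∀ k, ρ k ≤ 1)
    (hρB : ∀ k ∈ B, ρ k = 1) (hflow : ∀ k, k ∉ B → netInflow r ρ k ≤ 0) :
    IsAbsorbing r ind B := by
  refine Or.inr fun j hj => ?_
  have hjC : j ∈ insert j B := Finset.mem_insert_self j B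
  rw [lamA_eq_sum_generator hind hr hirr hjC]
  set h := ind (insert j B) j with hh
  have h1 : ∑ k, ρ k * generator r h k ≤ 0 := by
    rw [← sum_mul_netInflow]
    refine Finset.sum_nonpos fun k _ => ?_
    by_cases hk : k ∈ B
    · rw [hh, hind.apply_of_ne_s4 hjC (Finset.mem_insert_of_mem hk) (fun e => hj (e ▸ hk)), zero_mul]
    · exact mul_nonpos_of_nonneg_of_nonpos (hind.nonneg hr hirr hjC k) (hflow k hk)
  have h2 : ∑ k, (1 - ρ k) * generator r h k ≤ 0 := by
    refine Finset.sum_nonpos fun k _ => ?_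
    by_cases hk : k ∈ B
    · rw [hρB k hk, sub_self, zero_mul]
    by_cases hkj : k = j
    · rw [hkj]
      exact mul_nonpos_of_nonneg_of_nonpos (sub_nonneg.2 (hρ j))
        (hind.generator_self_nonpos hr hirr hjC)
    · rw [hh, hind.generator_eq_zero hjC (by simp [hkj, hk]), mul_zero]
  have h3 : ∑ k, generator r h k
      = ∑ k, ρ k * generator r h k + ∑ k, (1 - ρ k) * generator r h k := by
    rw [← Finset.sum_add_distrib]
    exact Finset.sum_congr rfl fun k _ => by ring
  linarith

theorem eq_zero_of_netInflow_eq_zero (hind : IsHarmFamily r ind) (hr : ∀ i j, 0 ≤ r i j)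
    (hirr : IrreducibleRates r) {A : Finset V} (hA : A.Nonempty) {z : V → ℝ}
    (hzA : ∀ k ∈ A, z k = 0) (hz : ∀ k, k ∉ A → netInflow r z k = 0) : z = 0 := by
  funext j
  by_cases hj : j ∈ A
  · exact hzA j hj
  have hjC : j ∈ insert j A := Finset.mem_insert_self j A
  have key := sum_mul_netInflow r (ind (insert j A) j) z
  rw [Finset.sum_eq_zero, Finset.sum_eq_single j] at key
  · exact (mul_eq_zero.1 key.symm).resolve_right (hind.generator_self_neg hr hirr hA hj).ne
  · intro k _ hkj
    by_cases hk : k ∈ A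
    · rw [hzA k hk, zero_mul]
    · rw [hind.generator_eq_zero hjC (by simp [hkj, hk]), mul_zero]
  · simp
  · intro k _
    by_cases hk : k ∈ A
    · rw [hind.apply_of_ne_s4 hjC (Finset.mem_insert_of_mem hk) (fun e => hj (e ▸ hk)), zero_mul]
    · rw [hz k hk, mul_zero]

theorem exists_netInflow_eq_zero (hind : IsHarmFamily r ind) (hr : ∀ i j, 0 ≤ r i j)
    (hirr : IrreducibleRates r) {A : Finset V} (hA : A.Nonempty) :
    ∃ ρ : V → ℝ, (∀ k ∈ A, ρ k = 1) ∧ ∀ k, k ∉ A → netInflow r ρ k = 0 := by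
  let F : (V → ℝ) →ₗ[ℝ] (V → ℝ) :=
    { toFun := fun z k => if k ∈ A then z k else netInflow r z k
      map_add' := fun x y => by
        funext k
        by_cases hk : k ∈ A
        · simp [hk]
        · simp only [hk, if_false, Pi.add_apply, netInflow, ← Finset.sum_add_distrib]
          exact Finset.sum_congr rfl fun l _ => by ring
      map_smul' := fun c x => by
        funext k
        by_cases hk : k ∈ A
        · simp [hk]
        · simp only [hk, if_false, Pi.smul_apply, smul_eq_mul, netInflow, Finset.mul_sum,
            RingHom.id_apply]
          exact Finset.sum_congr rfl fun l _ => by ring }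
  have hF : ∀ z k, F z k = if k ∈ A then z k else netInflow r z k := fun _ _ => rfl
  have hinj : Function.Injective F := by
    refine (injective_iff_map_eq_zero F).2 fun z hz => ?_
    refine eq_zero_of_netInflow_eq_zero hind hr hirr hA (fun k hk => ?_) (fun k hk => ?_)
    · simpa [hF, hk] using congrFun hz k
    · simpa [hF, hk] using congrFun hz k
  obtain ⟨ρ, hρ⟩ := LinearMap.injective_iff_surjective.1 hinj (fun k => if k ∈ A then 1 else 0)
  refine ⟨ρ, fun k hk => ?_, fun k hk => ?_⟩
  · simpa [hF, hk] using congrFun hρ k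
  · simpa [hF, hk] using congrFun hρ k

theorem lamA_eq_netInflow (hind : IsHarmFamily r ind) (hr : ∀ i j, 0 ≤ r i j)
    (hirr : IrreducibleRates r) {A : Finset V} {ρ : V → ℝ} (hρA : ∀ k ∈ A, ρ k = 1)
    (hρ : ∀ k, k ∉ A → netInflow r ρ k = 0) {i : V} (hi : i ∈ A) :
    lamA r ind A i = netInflow r ρ i := by
  rw [lamA_eq_sum_generator hind hr hirr hi]
  have h1 : ∑ k, generator r (ind A i) k = ∑ k, ρ k * generator r (ind A i) k := by
    refine Finset.sum_congr rfl fun k _ => ?_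
    by_cases hk : k ∈ A
    · rw [hρA k hk, one_mul]
    · rw [hind.generator_eq_zero hi hk, mul_zero]
  rw [h1, ← sum_mul_netInflow, Finset.sum_eq_single i, hind.apply_self_s4 hi, one_mul]
  · intro k _ hki
    by_cases hk : k ∈ A
    · rw [hind.apply_of_ne_s4 hi hk hki, zero_mul]
    · rw [hρ k hk, mul_zero]
  · simp

/-- A nonempty absorbing set carries stationary intensities bounded by `1`. -/
theorem IsAbsorbing.exists_intensity (hind : IsHarmFamily r ind) (hr : ∀ i j, 0 ≤ r i j)
    (hirr : IrreducibleRates r) {A : Finset V} (hA : A.Nonempty) (habs : IsAbsorbing r ind A) :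
    ∃ ρ : V → ℝ, (∀ k, ρ k ≤ 1) ∧ (∀ k ∈ A, ρ k = 1) ∧
      ∀ k, k ∉ A → netInflow r ρ k = 0 := by
  obtain ⟨ρ, hρA, hρ⟩ := exists_netInflow_eq_zero hind hr hirr hA
  refine ⟨ρ, fun j => ?_, hρA, hρ⟩
  by_cases hj : j ∈ A
  · exact (hρA j hj).le
  rcases habs with rfl | habs
  · exact absurd (Finset.mem_univ j) hj
  have hjC : j ∈ insert j A := Finset.mem_insert_self j A
  have hle := habs j hj
  rw [lamA_eq_sum_generator hind hr hirr hjC] at hle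
  set h := ind (insert j A) j with hh
  have h1 : ∑ k, ρ k * generator r h k = 0 := by
    rw [← sum_mul_netInflow]
    refine Finset.sum_eq_zero fun k _ => ?_
    by_cases hk : k ∈ A
    · rw [hh, hind.apply_of_ne_s4 hjC (Finset.mem_insert_of_mem hk) (fun e => hj (e ▸ hk)), zero_mul]
    · rw [hρ k hk, mul_zero]
  have h2 : ∑ k, (1 - ρ k) * generator r h k = (1 - ρ j) * generator r h j := by
    refine Finset.sum_eq_single j (fun k _ hkj => ?_) (by simp)
    by_cases hk : k ∈ A
    · rw [hρA k hk, sub_self, zero_mul]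
    · rw [hh, hind.generator_eq_zero hjC (by simp [hkj, hk]), mul_zero]
  have h3 : ∑ k, generator r h k
      = ∑ k, ρ k * generator r h k + ∑ k, (1 - ρ k) * generator r h k := by
    rw [← Finset.sum_add_distrib]
    exact Finset.sum_congr rfl fun k _ => by ring
  have hneg := hind.generator_self_neg hr hirr hA hj
  rw [← hh] at hneg
  by_contra! hcon
  nlinarith [mul_pos_of_neg_of_neg (sub_neg.2 hcon) hneg]

theorem IsAbsorbing.of_subset (hind : IsHarmFamily r ind) (hr : ∀ i j, 0 ≤ r i j)
    (hirr : IrreducibleRates r) {A B : Finset V} (hA : A.Nonempty) (habs : IsAbsorbing r ind A)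
    (hBA : B ⊆ A) (hlam : ∀ i ∈ A, i ∉ B → lamA r ind A i ≤ 0) : IsAbsorbing r ind B := by
  obtain ⟨ρ, hρ1, hρA, hρ⟩ := habs.exists_intensity hind hr hirr hA
  refine isAbsorbing_of_netInflow_nonpos hind hr hirr hρ1 (fun k hk => hρA k (hBA hk))
    fun k hk => ?_
  by_cases hkA : k ∈ A
  · rw [← lamA_eq_netInflow hind hr hirr hρA hρ hkA]
    exact hlam k hkA hk
  · exact (hρ k hkA).le

theorem IsAbsorbing.inter (hind : IsHarmFamily r ind) (hr : ∀ i j, 0 ≤ r i j)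
    (hirr : IrreducibleRates r) {A B : Finset V} (hA : A.Nonempty) (hB : B.Nonempty)
    (hAabs : IsAbsorbing r ind A) (hBabs : IsAbsorbing r ind B) :
    IsAbsorbing r ind (A ∩ B) := by
  obtain ⟨ρ, hρ1, hρA, hρ⟩ := hAabs.exists_intensity hind hr hirr hA
  obtain ⟨σ, hσ1, hσB, hσ⟩ := hBabs.exists_intensity hind hr hirr hB
  refine isAbsorbing_of_netInflow_nonpos (ρ := fun k => min (ρ k) (σ k)) hind hr hirr
    (fun k => (min_le_left _ _).trans (hρ1 k)) (fun k hk => ?_) fun k hk => ?_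
  · rw [Finset.mem_inter] at hk
    simp [hρA k hk.1, hσB k hk.2]
  · have of_left : k ∉ A → ρ k ≤ σ k → netInflow r (fun k => min (ρ k) (σ k)) k ≤ 0 :=
      fun hkA hle => (netInflow_mono hr (fun k => min_le_left _ _) (min_eq_left hle)).trans
        (hρ k hkA).le
    have of_right : k ∉ B → σ k ≤ ρ k → netInflow r (fun k => min (ρ k) (σ k)) k ≤ 0 :=
      fun hkB hle => (netInflow_mono hr (fun k => min_le_right _ _) (min_eq_right hle)).trans
        (hσ k hkB).le
    by_cases hkA : k ∈ A
    · have hkB : k ∉ B := fun h => hk (Finset.mem_inter.2 ⟨hkA, h⟩)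
      exact of_right hkB (hρA k hkA ▸ hσ1 k)
    · by_cases hkB : k ∈ B
      · exact of_left hkA (hσB k hkB ▸ hρ1 k)
      · exact (le_total (ρ k) (σ k)).elim (of_left hkA) (of_right hkB)

theorem subset_minAbs (r : V → V → ℝ) (ind : Finset V → V → V → ℝ) (S : Finset V) :
    S ⊆ minAbs r ind S := by
  classical
  intro i hi
  simp only [minAbs, Finset.mem_filter, Finset.mem_univ, true_and]
  exact fun A _ hSA => hSA hi

theorem minAbs_subset {S A : Finset V} (hA : IsAbsorbing r ind A) (hSA : S ⊆ A) :
    minAbs r ind S ⊆ A := by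
  classical
  intro i hi
  simp only [minAbs, Finset.mem_filter, Finset.mem_univ, true_and] at hi
  exact hi A hA hSA

theorem IsAbsorbing.minAbs_eq {S : Finset V} (hS : IsAbsorbing r ind S) :
    minAbs r ind S = S :=
  (minAbs_subset hS subset_rfl).antisymm (subset_minAbs r ind S)

theorem isAbsorbing_minAbs (hind : IsHarmFamily r ind) (hr : ∀ i j, 0 ≤ r i j)
    (hirr : IrreducibleRates r) {S : Finset V} (hS : S.Nonempty) :
    IsAbsorbing r ind (minAbs r ind S) := by
  classical
  obtain ⟨A, hA, hmin⟩ := Finset.exists_min_image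
    (Finset.univ.filter fun A : Finset V => IsAbsorbing r ind A ∧ S ⊆ A) Finset.card
    ⟨Finset.univ, Finset.mem_filter.2
      ⟨Finset.mem_univ _, Or.inl rfl, Finset.subset_univ S⟩⟩
  simp only [Finset.mem_filter, Finset.mem_univ, true_and] at hA hmin
  have heq : minAbs r ind S = A := by
    refine (minAbs_subset hA.1 hA.2).antisymm fun i hi => ?_
    simp only [minAbs, Finset.mem_filter, Finset.mem_univ, true_and]
    intro B hB hSB
    have hcard := hmin (A ∩ B) ⟨hA.1.inter hind hr hirr (hS.mono hA.2) (hS.mono hSB) hB,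
      Finset.subset_inter hA.2 hSB⟩
    have := Finset.eq_of_subset_of_card_le Finset.inter_subset_left hcard
    rw [← this] at hi
    exact (Finset.mem_inter.1 hi).2
  exact heq ▸ hA.1

theorem lamA_minAbs_pos (hind : IsHarmFamily r ind) (hr : ∀ i j, 0 ≤ r i j)
    (hirr : IrreducibleRates r) {S : Finset V} (hS : S.Nonempty) {i : V}
    (hi : i ∈ minAbs r ind S) (hiS : i ∉ S) : 0 < lamA r ind (minAbs r ind S) i := by
  by_contra! hle
  have hsub := subset_minAbs r ind S
  have habs : IsAbsorbing r ind ((minAbs r ind S).erase i) := by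
    refine (isAbsorbing_minAbs hind hr hirr hS).of_subset hind hr hirr (hS.mono hsub)
      (Finset.erase_subset _ _) fun k hk hke => ?_
    have : k = i := by
      by_contra hki
      exact hke (Finset.mem_erase.2 ⟨hki, hk⟩)
    rwa [this]
  have := minAbs_subset habs
    (fun k hk => Finset.mem_erase.2 ⟨fun e => hiS (e ▸ hk), hsub hk⟩) hi
  exact Finset.notMem_erase _ _ this

end ZeroRange

/-- if the exit time `T^u = inf{t ≥ 0 : u + t·λ^u ∉ Σ}` is finite
(i.e. the defining set is nonempty), then for `v = u + T^u·λ^u` the support `𝒮(v)`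
is `r`-absorbing, so `𝒮(v) = 𝒜(v)`, and `𝒮(v) ⊊ 𝒜(u)`. -/
theorem support_at_exit_time (V : Type*) [Fintype V] [DecidableEq V] [Nonempty V]
    (r : V → V → ℝ) (hr_nonneg : ∀ i j, 0 ≤ r i j) (hr_diag : ∀ i, r i i = 0)
    (hr_irr : IrreducibleRates r)
    (ind : Finset V → V → V → ℝ) (hind : IsHarmFamily r ind)
    (u : V → ℝ) (hu : u ∈ stdSimplex ℝ V)
    (lamU : V → ℝ)
    (hlamU : ∀ i, lamU i =
      if i ∈ minAbs r ind (suppF u) then lamA r ind (minAbs r ind (suppF u)) i else 0)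
    (hne : {t : ℝ | 0 ≤ t ∧ (fun i => u i + t * lamU i) ∉ stdSimplex ℝ V}.Nonempty)
    (T : ℝ) (hT : T = sInf {t : ℝ | 0 ≤ t ∧ (fun i => u i + t * lamU i) ∉ stdSimplex ℝ V})
    (v : V → ℝ) (hv : ∀ i, v i = u i + T * lamU i) :
    IsAbsorbing r ind (suppF v) ∧ suppF v = minAbs r ind (suppF v) ∧
      suppF v ⊂ minAbs r ind (suppF u) := by
  have hS : (suppF u).Nonempty := by
    by_contra! h
    have hle : ∀ i, u i ≤ 0 := fun i => by
      by_contra! hi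
      exact Finset.notMem_empty i (h ▸ mem_suppF.2 hi)
    have := hu.2
    linarith [Finset.sum_nonpos fun i (_ : i ∈ Finset.univ) => hle i]
  have hsub := subset_minAbs r ind (suppF u)
  have habs := isAbsorbing_minAbs hind hr_nonneg hr_irr hS
  have hpos := fun i => lamA_minAbs_pos (i := i) hind hr_nonneg hr_irr hS
  have hsum := sum_lamA r ind (minAbs r ind (suppF u))
  generalize minAbs r ind (suppF u) = A at *
  have hd : ∑ i, lamU i = 0 := by
    rw [← hsum, ← Finset.sum_subset (Finset.subset_univ A)
      fun i _ hi => by rw [hlamU, if_neg hi]]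
    exact Finset.sum_congr rfl fun i hi => by rw [hlamU, if_pos hi]
  have hdA : ∀ i, lamU i < 0 → i ∈ A := by
    intro i hi
    by_contra hiA
    rw [hlamU, if_neg hiA] at hi
    exact lt_irrefl _ hi
  have hdpos : ∀ i, lamU i < 0 → 0 < u i := by
    intro i hi
    by_contra hui
    have := hpos i (hdA i hi) (fun h => hui (mem_suppF.1 h))
    rw [← (hlamU i).trans (if_pos (hdA i hi))] at this
    linarith
  obtain ⟨τ, hτ, hinf, hnonneg, m, hm, hmz⟩ := sInf_exit_stdSimplex hu hd hdpos hne
  rw [hinf] at hT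
  subst hT
  have hvA : suppF v ⊆ A := by
    intro i hi
    by_contra hiA
    rw [mem_suppF, hv, hlamU, if_neg hiA, mul_zero, add_zero] at hi
    exact hiA (hsub (mem_suppF.2 hi))
  have hvabs : IsAbsorbing r ind (suppF v) := by
    refine habs.of_subset hind hr_nonneg hr_irr (hS.mono hsub) hvA fun i hiA hiv => ?_
    have hle : u i + T * lamU i ≤ 0 := by
      rw [← hv]
      exact not_lt.1 fun h => hiv (mem_suppF.2 h)
    rw [hlamU, if_pos hiA] at hle
    by_contra! hcon
    linarith [mul_pos hτ hcon, hu.1 i]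
  refine ⟨hvabs, hvabs.minAbs_eq.symm, (Finset.ssubset_iff_of_subset hvA).2
    ⟨m, hdA m hm, fun h => ?_⟩⟩
  rw [mem_suppF, hv, hmz] at h
  exact lt_irrefl _ h
end
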